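/- arXiv:1612.01361 — 3 statements merged into one kernel-verified Lean document; each statement's English description precedes it below -/
import Mathlib

section
/- Let k = |B|^t − |B|^{t−1}. For every polynomial f ∈ F[x] with deg f ≤ k − 1, every u ∈ F, and every α* ∈ F, the repair identity u·f(α*) = − Σ_{α ∈ F, α ≠ α*} p_{u,α*}(α)·f(α) holds; equivalently, Σ_{α ∈ F} p_{u,α*}(α)·f(α) = 0. -/
open Polynomial

/-- The check polynomial `p_{u,α}(x) = ∑_{i=0}^{t-1} u^{q^i} (x - α)^{q^i - 1}`. -/
noncomputable def pPoly (q t : ℕ) {F : Type*} [Field F] (u α : F) : Polynomial F :=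
  ∑ i ∈ Finset.range t, Polynomial.C (u ^ q ^ i) * (Polynomial.X - Polynomial.C α) ^ (q ^ i - 1)

/-- The values of a polynomial of degree less than `|K| - 1` over a finite field `K` sum to zero. -/
theorem sum_eval_eq_zero_of_natDegree_lt {K : Type*} [Field K] [Fintype K] (g : K[X])
    (hg : g.natDegree < Fintype.card K - 1) : ∑ x : K, g.eval x = 0 := by
  simp_rw [eval_eq_sum_range]
  rw [Finset.sum_comm]
  refine Finset.sum_eq_zero fun i hi => ?_
  rw [← Finset.mul_sum, FiniteField.sum_pow_lt_card_sub_one K i, mul_zero]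
  exact (Nat.lt_succ_iff.mp (Finset.mem_range.mp hi)).trans_lt hg

theorem natDegree_pPoly_le {F : Type*} [Field F] {q : ℕ} (hq : 0 < q) (t : ℕ) (u α : F) :
    (pPoly q t u α).natDegree ≤ q ^ (t - 1) - 1 := by
  refine natDegree_sum_le_of_forall_le _ _ fun i hi => ?_
  refine (natDegree_C_mul_le _ _).trans (natDegree_pow_le.trans ?_)
  rw [natDegree_X_sub_C, mul_one]
  have hit : i ≤ t - 1 := by have := Finset.mem_range.mp hi; lia
  exact Nat.sub_le_sub_right (Nat.pow_le_pow_right hq hit) 1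

theorem eval_pPoly_self {F : Type*} [Field F] {q t : ℕ} (hq : 1 < q) (ht : 0 < t) (u α : F) :
    (pPoly q t u α).eval α = u := by
  rw [pPoly, eval_finsetSum, Finset.sum_eq_single_of_mem 0 (Finset.mem_range.mpr ht)]
  · simp
  · intro i _ hi
    have h : q ^ i - 1 ≠ 0 := by have := Nat.one_lt_pow hi hq; lia
    simp [h]

/-- With `k = |B|^t - |B|^{t-1}`: for every `f ∈ F[x]` with `deg f ≤ k - 1`, every
`u ∈ F` and every `α* ∈ F`, the repair identity
`u·f(α*) = - ∑_{α ≠ α*} p_{u,α*}(α)·f(α)` holds; equivalently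
`∑_{α ∈ F} p_{u,α*}(α)·f(α) = 0`. -/
theorem stmt6 (p m t : ℕ) (hp : p.Prime) (hm : 0 < m) (ht : 0 < t)
    (B F : Type*) [Field B] [Field F] [Algebra B F] [Fintype B] [Fintype F] [DecidableEq F]
    (hB : Fintype.card B = p ^ m) (hF : Fintype.card F = Fintype.card B ^ t)
    (k : ℕ) (hk : k = Fintype.card B ^ t - Fintype.card B ^ (t - 1))
    (f : Polynomial F) (hf : f.degree ≤ ((k - 1 : ℕ) : WithBot ℕ)) (u αs : F) :
    u * f.eval αs
        = - ∑ α ∈ Finset.univ.erase αs, (pPoly (Fintype.card B) t u αs).eval α * f.eval α ∧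
      ∑ α : F, (pPoly (Fintype.card B) t u αs).eval α * f.eval α = 0 := by
  have hq : 1 < Fintype.card B := Fintype.one_lt_card
  have hsum : ∑ α : F, (pPoly (Fintype.card B) t u αs).eval α * f.eval α = 0 := by
    simp_rw [← eval_mul]
    apply sum_eval_eq_zero_of_natDegree_lt
    have hdeg := natDegree_mul_le_of_le (natDegree_pPoly_le (zero_lt_one.trans hq) t u αs)
      (natDegree_le_of_degree_le hf)
    have hpos : 0 < Fintype.card B ^ (t - 1) := pow_pos (zero_lt_one.trans hq) _
    have hlt : Fintype.card B ^ (t - 1) < Fintype.card B ^ t :=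
      Nat.pow_lt_pow_right hq (Nat.sub_lt ht one_pos)
    rw [hF]
    lia
  refine ⟨?_, hsum⟩
  rw [← Finset.add_sum_erase _ _ (Finset.mem_univ αs), eval_pPoly_self hq ht] at hsum
  exact eq_neg_of_add_eq_zero_left hsum
end

section
/- (Guruswami–Wootters single-erasure recoverability.) Let k = |B|^t − |B|^{t−1} and let α* ∈ F. If f ∈ F[x] is a polynomial with deg f ≤ k − 1 such that Tr_{F/B}(f(α)/(α − α*)) = 0 for every α ∈ F with α ≠ α*, then f(α*) = 0. Consequently, the value f(α*) of any such f is determined by the |F| − 1 sub-symbols Tr_{F/B}(f(α)/(α − α*)) ∈ B, α ∈ F \ {α*}. -/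
open Polynomial

/-- The field trace `Tr_{F/B}(x) = ∑_{i=0}^{t-1} x^{q^i}` (with `q = |B|`). -/
noncomputable def fTr (q t : ℕ) {F : Type*} [Field F] (x : F) : F :=
  ∑ i ∈ Finset.range t, x ^ q ^ i

/-- A polynomial of degree less than `|F| - 1` sums to zero over the finite field `F`. -/
theorem sum_eval_eq_zero_of_natDegree_lt_s8 {F : Type*} [Field F] [Fintype F] (f : F[X])
    (hf : f.natDegree < Fintype.card F - 1) : ∑ x : F, f.eval x = 0 := by
  simp_rw [eval_eq_sum_range]
  rw [Finset.sum_comm]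
  refine Finset.sum_eq_zero fun i hi => ?_
  rw [← Finset.mul_sum, FiniteField.sum_pow_lt_card_sub_one, mul_zero]
  have := Finset.mem_range.mp hi
  omega

theorem algebraMap_trace_eq_fTr {B F : Type*} [Field B] [Field F] [Algebra B F] [Fintype B]
    [Finite F] (x : F) :
    algebraMap B F (Algebra.trace B F x) = fTr (Fintype.card B) (Module.finrank B F) x := by
  rw [FiniteField.algebraMap_trace_eq_sum_pow, fTr, Nat.card_eq_fintype_card]

/-- The polynomial `Tr(ζ (X - a)) / (X - a)`. -/
noncomputable def repairPoly (q t : ℕ) {F : Type*} [Field F] (a ζ : F) : F[X] :=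
  ∑ i ∈ Finset.range t, C (ζ ^ q ^ i) * (X - C a) ^ (q ^ i - 1)

theorem natDegree_repairPoly_le {q : ℕ} (hq : 0 < q) (t : ℕ) {F : Type*} [Field F] (a ζ : F) :
    (repairPoly q t a ζ).natDegree ≤ q ^ (t - 1) - 1 := by
  refine natDegree_sum_le_of_forall_le _ _ fun i hi => ?_
  refine (natDegree_C_mul_le _ _).trans ?_
  rw [natDegree_pow, natDegree_X_sub_C, mul_one]
  have hi := Finset.mem_range.mp hi
  exact Nat.sub_le_sub_right (Nat.pow_le_pow_right hq (by omega)) 1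

theorem eval_repairPoly_self {q t : ℕ} (hq : 1 < q) (ht : 0 < t) {F : Type*} [Field F]
    (a ζ : F) : (repairPoly q t a ζ).eval a = ζ := by
  rw [repairPoly, eval_finsetSum, Finset.sum_eq_single_of_mem 0 (Finset.mem_range.mpr ht)]
  · simp
  · intro i _ hi
    have : q ^ i - 1 ≠ 0 := by
      have := Nat.one_lt_pow hi hq
      omega
    simp [this]

theorem eval_repairPoly_of_ne {q : ℕ} (hq : 0 < q) (t : ℕ) {F : Type*} [Field F]
    {a x : F} (hx : x ≠ a) (ζ : F) :
    (repairPoly q t a ζ).eval x = fTr q t (ζ * (x - a)) / (x - a) := by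
  have hxa : x - a ≠ 0 := sub_ne_zero.mpr hx
  rw [eq_div_iff hxa, repairPoly, fTr, eval_finsetSum, Finset.sum_mul]
  refine Finset.sum_congr rfl fun i _ => ?_
  simp only [eval_mul, eval_C, eval_pow, eval_sub, eval_X]
  rw [mul_assoc, pow_sub_one_mul (pow_pos hq i).ne', mul_pow]

theorem eval_eq_zero_of_fTr_eq_zero {B F : Type*} [Field B] [Field F] [Algebra B F]
    [Fintype B] [Fintype F] (a : F) (f : F[X])
    (hf : f.natDegree + Fintype.card B ^ (Module.finrank B F - 1) < Fintype.card F)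
    (h : ∀ x : F, x ≠ a →
      fTr (Fintype.card B) (Module.finrank B F) (f.eval x / (x - a)) = 0) :
    f.eval a = 0 := by
  classical
  set q := Fintype.card B
  set t := Module.finrank B F
  have hq : 1 < q := Fintype.one_lt_card
  have ht : 0 < t := Module.finrank_pos
  refine (traceForm_nondegenerate B F).1 _ fun ζ => ?_
  have hdeg : (f * repairPoly q t a ζ).natDegree < Fintype.card F - 1 := by
    have h1 := natDegree_mul_le (p := f) (q := repairPoly q t a ζ)
    have h2 := natDegree_repairPoly_le (by omega : 0 < q) t a ζ
    have h3 : 0 < q ^ (t - 1) := by positivity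
    omega
  have hsum := sum_eval_eq_zero_of_natDegree_lt_s8 _ hdeg
  rw [← Finset.add_sum_erase _ _ (Finset.mem_univ a), eval_mul,
    eval_repairPoly_self hq ht] at hsum
  have htr := congrArg (Algebra.trace B F) hsum
  rw [map_add, map_sum, map_zero, Finset.sum_eq_zero, add_zero] at htr
  · rwa [Algebra.traceForm_apply]
  intro x hx
  have hxa := Finset.ne_of_mem_erase hx
  have hz : Algebra.trace B F (f.eval x / (x - a)) = 0 :=
    (algebraMap B F).injective <| by rw [algebraMap_trace_eq_fTr, h x hxa, map_zero]
  rw [eval_mul, eval_repairPoly_of_ne (by omega) t hxa, ← algebraMap_trace_eq_fTr,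
    mul_div_assoc', mul_comm, mul_div_assoc, ← Algebra.smul_def, map_smul, hz, smul_zero]

/-- Guruswami–Wootters single-erasure recoverability. With `k = |B|^t - |B|^{t-1}` and
`α* ∈ F`: if `f` has `deg f ≤ k - 1` and `Tr(f(α)/(α-α*)) = 0` for every `α ≠ α*`, then
`f(α*) = 0`. Consequently the value `f(α*)` of any such `f` is determined by the
sub-symbols `Tr(f(α)/(α-α*))`, `α ∈ F \ {α*}`. -/
theorem stmt8 (p m t : ℕ) (hp : p.Prime) (hm : 0 < m) (ht : 0 < t)
    (B F : Type*) [Field B] [Field F] [Algebra B F] [Fintype B] [Fintype F]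
    (hB : Fintype.card B = p ^ m) (hF : Fintype.card F = Fintype.card B ^ t)
    (k : ℕ) (hk : k = Fintype.card B ^ t - Fintype.card B ^ (t - 1)) (αs : F) :
    (∀ f : Polynomial F, f.degree ≤ ((k - 1 : ℕ) : WithBot ℕ) →
      (∀ α : F, α ≠ αs → fTr (Fintype.card B) t (f.eval α / (α - αs)) = 0) →
      f.eval αs = 0) ∧
    (∀ f g : Polynomial F, f.degree ≤ ((k - 1 : ℕ) : WithBot ℕ) →
      g.degree ≤ ((k - 1 : ℕ) : WithBot ℕ) →
      (∀ α : F, α ≠ αs →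
        fTr (Fintype.card B) t (f.eval α / (α - αs))
          = fTr (Fintype.card B) t (g.eval α / (α - αs))) →
      f.eval αs = g.eval αs) := by
  have hq : 1 < Fintype.card B := Fintype.one_lt_card
  obtain rfl : t = Module.finrank B F :=
    Nat.pow_right_injective hq (hF.symm.trans Module.card_eq_pow_finrank)
  have key : ∀ f : F[X], f.degree ≤ ((k - 1 : ℕ) : WithBot ℕ) →
      (∀ α : F, α ≠ αs →
        fTr (Fintype.card B) (Module.finrank B F) (f.eval α / (α - αs)) = 0) →
      f.eval αs = 0 := by
    intro f hf h
    refine eval_eq_zero_of_fTr_eq_zero αs f ?_ h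
    have hdeg := natDegree_le_of_degree_le hf
    have hlt : Fintype.card B ^ (Module.finrank B F - 1) <
        Fintype.card B ^ Module.finrank B F := Nat.pow_lt_pow_right hq (by omega)
    omega
  refine ⟨key, fun f g hf hg h => ?_⟩
  rw [← sub_eq_zero, ← eval_sub]
  refine key _ ((degree_sub_le f g).trans (max_le hf hg)) fun α hα => ?_
  rw [eval_sub, sub_div, ← algebraMap_trace_eq_fTr, map_sub, map_sub, algebraMap_trace_eq_fTr,
    algebraMap_trace_eq_fTr, h α hα, sub_self]
end

section
/- (Activation Lemma, second cancellation.) Assume the extension degree t is divisible by the characteristic p of F. Let α, β, γ ∈ F be three distinct elements such that (β − α)/(β − γ) ∈ K, where K = ker(Tr_{F/B}). Then (α − γ)/(γ − β) ∈ K, and for every v ∈ F, the element p_{v,β}(γ) = Tr_{F/B}(v(γ − β))/(γ − β) satisfies Tr_{F/B}(p_{v,β}(γ)·(α − γ)) = 0; that is, p_{v,β}(γ) lies in the root space K_{γ,α} = {z ∈ F : Tr_{F/B}(z(α − γ)) = 0}. -/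
open Polynomial

theorem fTr_sub_one {p m t : ℕ} [Fact p.Prime] {F : Type*} [Field F] [CharP F p] (hpt : p ∣ t)
    (x : F) : fTr (p ^ m) t (x - 1) = fTr (p ^ m) t x := by
  have h : (t : F) = 0 := (CharP.cast_eq_zero_iff F p t).2 hpt
  simp [fTr, ← pow_mul, sub_pow_char_pow, h]

theorem fTr_pow_card {p m t : ℕ} [Fact p.Prime] {F : Type*} [Field F] [Fintype F] [CharP F p]
    (hF : Fintype.card F = (p ^ m) ^ t) (x : F) :
    fTr (p ^ m) t x ^ p ^ m = fTr (p ^ m) t x := by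
  have hx : x ^ (p ^ m) ^ t = x := hF ▸ FiniteField.pow_card x
  unfold fTr
  rw [sum_pow_char_pow]
  simp only [← pow_mul x, ← pow_succ (p ^ m)]
  have h := Finset.sum_range_succ (fun i => x ^ (p ^ m) ^ i) t
  rw [Finset.sum_range_succ', hx, pow_zero, pow_one] at h
  exact add_right_cancel h

theorem fTr_mul_of_pow_eq {q t : ℕ} {F : Type*} [Field F] {c : F} (hc : c ^ q = c) (x : F) :
    fTr q t (c * x) = c * fTr q t x := by
  have h (i : ℕ) : c ^ q ^ i = c := by
    induction i with
    | zero => simp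
    | succ i ih => rw [pow_succ, pow_mul, ih, hc]
  simp [fTr, mul_pow, h, Finset.mul_sum]

theorem eval_pPoly {q t : ℕ} (hq : 0 < q) {F : Type*} [Field F] (u : F) {α β : F} (h : β ≠ α) :
    (pPoly q t u α).eval β = fTr q t (u * (β - α)) / (β - α) := by
  have h0 : β - α ≠ 0 := sub_ne_zero.2 h
  rw [eq_div_iff h0]
  simp only [pPoly, fTr, eval_finsetSum, Finset.sum_mul, eval_mul, eval_C, eval_pow, eval_sub,
    eval_X, mul_pow]
  refine Finset.sum_congr rfl fun i _ => ?_
  rw [mul_assoc, pow_sub_one_mul (pow_pos hq i).ne']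

/-- Activation Lemma, second cancellation. Assume `p ∣ t`. If `α, β, γ ∈ F` are distinct
with `(β-α)/(β-γ) ∈ K = ker Tr`, then `(α-γ)/(γ-β) ∈ K`, and for every `v ∈ F` the
element `p_{v,β}(γ)` satisfies `Tr(p_{v,β}(γ)·(α-γ)) = 0`, i.e. it lies in the root
space `K_{γ,α}`. -/
theorem stmt16 (p m t : ℕ) (hp : p.Prime) (hm : 0 < m) (ht : 0 < t)
    (B F : Type*) [Field B] [Field F] [Algebra B F] [Fintype B] [Fintype F]
    (hB : Fintype.card B = p ^ m) (hF : Fintype.card F = Fintype.card B ^ t)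
    [CharP F p] (hpt : p ∣ t)
    (α β γ : F) (hab : α ≠ β) (hbc : β ≠ γ) (hac : α ≠ γ)
    (hκ : fTr (Fintype.card B) t ((β - α) / (β - γ)) = 0) :
    fTr (Fintype.card B) t ((α - γ) / (γ - β)) = 0 ∧
    ∀ v : F,
      fTr (Fintype.card B) t ((pPoly (Fintype.card B) t v β).eval γ * (α - γ)) = 0 := by
  have : Fact p.Prime := ⟨hp⟩
  rw [hB] at hF hκ ⊢
  have hβγ : β - γ ≠ 0 := sub_ne_zero.2 hbc
  have hγβ : γ - β ≠ 0 := sub_ne_zero.2 hbc.symm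
  have key : (α - γ) / (γ - β) = (β - α) / (β - γ) - 1 := by
    field_simp
    ring
  have h : fTr (p ^ m) t ((α - γ) / (γ - β)) = 0 := by
    rw [key, fTr_sub_one hpt, hκ]
  refine ⟨h, fun v => ?_⟩
  rw [eval_pPoly (pow_pos hp.pos m) v hbc.symm, div_mul_eq_mul_div, mul_div_assoc,
    fTr_mul_of_pow_eq (fTr_pow_card hF _), h, mul_zero]
end
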